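/- arXiv:2404.19681 — 4 statements merged into one kernel-verified Lean document; each statement's English description precedes it below -/
import Mathlib

section
/- Let (X, ρ_X) and (Y, ρ_Y) be pointed proper metric spaces. Suppose that for every ε > 0 there exist a proper metric space Z, a point ρ_Z ∈ Z, and isometric embeddings f : X → Z and g : Y → Z with f(ρ_X) = ρ_Z = g(ρ_Y) such that D_{ρ_Z}(f(X), g(Y)) < ε, where D_{ρ_Z} is the local Hausdorff distance with basepoint ρ_Z. Then there exists a surjective isometry h : X → Y with h(ρ_X) = ρ_Y. -/
open Metric Set MeasureTheory Filter
open scoped ENNReal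

universe u v

/-- The local Hausdorff distance with basepoint `ρ` between closed subsets of a metric
space: `D_ρ(A,B) := ∫_{(0,∞)} e^{-r} · min(1, dHe(A ∩ B̄(ρ,r), B ∩ B̄(ρ,r))) dr`,
with values in `ℝ≥0∞`. -/
noncomputable def localHausdorffDist {X : Type*} [PseudoMetricSpace X] (ρ : X)
    (A B : Set X) : ℝ≥0∞ :=
  ∫⁻ r in Set.Ioi (0 : ℝ),
    ENNReal.ofReal (Real.exp (-r)) *
      min 1 (EMetric.hausdorffEdist (A ∩ Metric.closedBall ρ r) (B ∩ Metric.closedBall ρ r))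

/-- If the local Hausdorff distance is small, then `A` and `B` are Hausdorff-close in some ball
whose radius lies between `s` and `s + 1`. -/
theorem exists_hausdorffEDist_lt_of_localHausdorffDist_lt {Z : Type*} [PseudoMetricSpace Z]
    {ρ : Z} {A B : Set Z} {s : ℝ} (hs : 0 ≤ s) {δ : ℝ≥0∞} (hδ : δ ≤ 1)
    (h : localHausdorffDist ρ A B < ENNReal.ofReal (Real.exp (-(s + 1))) * δ) :
    ∃ r, s ≤ r ∧ hausdorffEDist (A ∩ closedBall ρ r) (B ∩ closedBall ρ r) < δ := by
  by_contra! hfar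
  refine h.not_ge ?_
  calc ENNReal.ofReal (Real.exp (-(s + 1))) * δ
      = ∫⁻ _ in Ioo s (s + 1), ENNReal.ofReal (Real.exp (-(s + 1))) * δ := by simp
    _ ≤ ∫⁻ r in Ioo s (s + 1), ENNReal.ofReal (Real.exp (-r)) *
          min 1 (hausdorffEDist (A ∩ closedBall ρ r) (B ∩ closedBall ρ r)) := by
        refine setLIntegral_mono' measurableSet_Ioo fun r hr => ?_
        gcongr
        · exact hr.2.le
        · exact le_min hδ (hfar r hr.1.le)
    _ ≤ localHausdorffDist ρ A B :=
        lintegral_mono_set fun r hr => hs.trans_lt hr.1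

/-- In a proper space, a sequence bounded with respect to some point converges along any
ultrafilter. -/
theorem exists_tendsto_of_eventually_dist_le {ι Y : Type*} [PseudoMetricSpace Y] [ProperSpace Y]
    (U : Ultrafilter ι) {u : ι → Y} {y : Y} {C : ℝ} (hu : ∀ᶠ n in U, dist (u n) y ≤ C) :
    ∃ a, Tendsto u U (nhds a) := by
  obtain ⟨a, -, ha⟩ := (isCompact_closedBall y C).ultrafilter_le_nhds (U.map u)
    (le_principal_iff.2 hu)
  exact ⟨a, ha⟩

/-- **Positive definiteness of the root-preserving local Gromov–Hausdorff distance**: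
if two pointed proper metric spaces `(X, ρX)` and `(Y, ρY)` can be isometrically
embedded, in a root-preserving way, into common pointed proper metric spaces with local
Hausdorff distance of the images less than any given `ε > 0`, then they are
rooted-isometric. -/
theorem rooted_isometric_of_localHausdorffDist_small
    {X : Type u} {Y : Type v} [MetricSpace X] [ProperSpace X]
    [MetricSpace Y] [ProperSpace Y] (ρX : X) (ρY : Y)
    (h : ∀ ε : ℝ≥0∞, 0 < ε →
      ∃ (Z : Type (max u v)) (_ : MetricSpace Z), ProperSpace Z ∧
        ∃ (ρZ : Z) (f : X → Z) (g : Y → Z),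
          Isometry f ∧ Isometry g ∧ f ρX = ρZ ∧ g ρY = ρZ ∧
          localHausdorffDist ρZ (Set.range f) (Set.range g) < ε) :
    ∃ h : X → Y, Isometry h ∧ Function.Surjective h ∧ h ρX = ρY := by
  have approx (n : ℕ) : ∃ (F : X → Y) (G : Y → X),
      (∀ x y, dist x ρX ≤ n → dist y ρY ≤ n →
        |dist (F x) y - dist x (G y)| ≤ 2 * (1 / ((n : ℝ) + 1))) ∧
      (∀ x, dist x ρX ≤ n → |dist (F x) ρY - dist x ρX| ≤ 1 / ((n : ℝ) + 1)) ∧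
      (∀ y, dist y ρY ≤ n → |dist (G y) ρX - dist y ρY| ≤ 1 / ((n : ℝ) + 1)) := by
    have hpos : (0 : ℝ) < 1 / ((n : ℝ) + 1) := Nat.one_div_pos_of_nat
    have hle : ENNReal.ofReal (1 / ((n : ℝ) + 1)) ≤ 1 :=
      ENNReal.ofReal_le_one.2 (div_le_one_of_le₀ (by simp) (by positivity))
    obtain ⟨Z, _, -, ρZ, f, g, hf, hg, hfρ, hgρ, hlt⟩ :=
      h (ENNReal.ofReal (Real.exp (-((n : ℝ) + 1))) * ENNReal.ofReal (1 / ((n : ℝ) + 1)))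
        (ENNReal.mul_pos (ENNReal.ofReal_pos.2 (Real.exp_pos _)).ne'
          (ENNReal.ofReal_pos.2 hpos).ne')
    obtain ⟨r, hnr, hr⟩ :=
      exists_hausdorffEDist_lt_of_localHausdorffDist_lt n.cast_nonneg hle hlt
    have hF (x : X) : ∃ y : Y, dist x ρX ≤ n → dist (f x) (g y) < 1 / ((n : ℝ) + 1) := by
      by_cases hx : dist x ρX ≤ n
      · obtain ⟨_, ⟨⟨y, rfl⟩, -⟩, hy⟩ := exists_edist_lt_of_hausdorffEDist_lt
          (show f x ∈ range f ∩ closedBall ρZ r from ⟨mem_range_self x, by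
            rw [mem_closedBall, ← hfρ, hf.dist_eq]; exact hx.trans hnr⟩) hr
        exact ⟨y, fun _ => (edist_lt_ofReal).1 hy⟩
      · exact ⟨ρY, fun h => absurd h hx⟩
    have hG (y : Y) : ∃ x, dist y ρY ≤ n → dist (f x) (g y) < 1 / ((n : ℝ) + 1) := by
      by_cases hy : dist y ρY ≤ n
      · rw [hausdorffEDist_comm] at hr
        obtain ⟨_, ⟨⟨x, rfl⟩, -⟩, hx⟩ := exists_edist_lt_of_hausdorffEDist_lt
          (show g y ∈ range g ∩ closedBall ρZ r from ⟨mem_range_self y, by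
            rw [mem_closedBall, ← hgρ, hg.dist_eq]; exact hy.trans hnr⟩) hr
        exact ⟨x, fun _ => by rw [dist_comm]; exact (edist_lt_ofReal).1 hx⟩
      · exact ⟨ρX, fun h => absurd h hy⟩
    choose F hF using hF
    choose G hG using hG
    refine ⟨F, G, fun x y hx hy => ?_, fun x hx => ?_, fun y hy => ?_⟩
    · rw [← hg.dist_eq, ← hf.dist_eq, ← Real.dist_eq]
      refine (dist_dist_dist_le _ _ _ _).trans ?_
      rw [dist_comm (g (F x)), dist_comm (g y)]
      linarith [hF x hx, hG y hy]
    · rw [← hg.dist_eq, ← hf.dist_eq, hfρ, hgρ, ← Real.dist_eq]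
      refine (dist_dist_dist_le_left _ _ _).trans ?_
      rw [dist_comm]
      exact (hF x hx).le
    · rw [← hg.dist_eq, ← hf.dist_eq, hfρ, hgρ, ← Real.dist_eq]
      exact (dist_dist_dist_le_left _ _ _).trans (hG y hy).le
  choose F G hFG hF hG using approx
  let U : Ultrafilter ℕ := Ultrafilter.of atTop
  have hU : (U : Filter ℕ) ≤ atTop := Ultrafilter.of_le atTop
  have hlarge (c : ℝ) : ∀ᶠ n : ℕ in U, c ≤ n :=
    (tendsto_natCast_atTop_atTop.mono_left hU).eventually_ge_atTop c
  have hzero : Tendsto (fun n : ℕ => 1 / ((n : ℝ) + 1)) U (nhds 0) :=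
    tendsto_one_div_add_atTop_nhds_zero_nat.mono_left hU
  have hone (n : ℕ) : 1 / ((n : ℝ) + 1) ≤ 1 :=
    div_le_one_of_le₀ (by simp) (by positivity)
  have hlimF (x : X) : ∃ y, Tendsto (fun n => F n x) U (nhds y) := by
    refine exists_tendsto_of_eventually_dist_le U (y := ρY) (C := dist x ρX + 1) ?_
    filter_upwards [hlarge (dist x ρX)] with n hn
    linarith [(abs_le.1 (hF n x hn)).2, hone n]
  have hlimG (y : Y) : ∃ x, Tendsto (fun n => G n y) U (nhds x) := by
    refine exists_tendsto_of_eventually_dist_le U (y := ρX) (C := dist y ρY + 1) ?_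
    filter_upwards [hlarge (dist y ρY)] with n hn
    linarith [(abs_le.1 (hG n y hn)).2, hone n]
  choose φ hφ using hlimF
  choose ψ hψ using hlimG
  have adj (x : X) (y : Y) : dist (φ x) y = dist x (ψ y) := by
    refine sub_eq_zero.1 (tendsto_nhds_unique
      (((hφ x).dist tendsto_const_nhds).sub (tendsto_const_nhds.dist (hψ y))) ?_)
    refine squeeze_zero_norm' ?_ (mul_zero (2 : ℝ) ▸ hzero.const_mul 2)
    filter_upwards [hlarge (dist x ρX), hlarge (dist y ρY)] with n hx hy
    exact hFG n x y hx hy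
  have hφψ (y : Y) : φ (ψ y) = y := dist_eq_zero.1 (by rw [adj, dist_self])
  have hψφ (x : X) : ψ (φ x) = x := (dist_eq_zero.1 (by rw [← adj, dist_self])).symm
  refine ⟨φ, Isometry.of_dist_eq fun x x' => by rw [adj, hψφ], fun y => ⟨ψ y, hφψ y⟩, ?_⟩
  refine dist_eq_zero.1 (tendsto_nhds_unique ((hφ ρX).dist tendsto_const_nhds) ?_)
  refine squeeze_zero (fun _ => dist_nonneg) (fun n => ?_) hzero
  simpa using hF n ρX (by simp)
end

section
/- Let X be a proper metric space, A ⊆ X a closed subset, and x ∈ X. Then for every r > 0: (right continuity) dHe(A ∩ B̄(x,s), A ∩ B̄(x,r)) → 0 as s → r from the right; (left limits) dHe(A ∩ B̄(x,s), closure(A ∩ B(x,r))) → 0 as s → r from the left. In particular, the map r ↦ A ∩ B̄(x,r), with the extended Hausdorff distance, is càdlàg on (0,∞) with left limit at r equal to the closure of A ∩ B(x,r). -/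
open Metric Set Filter
open scoped ENNReal Topology

/-- In a proper metric space, the restrictions of a closed set to the closed balls
`closedBall x s` with `s` slightly larger than `r` lie in any given neighborhood of the
restriction to `closedBall x r`. -/
theorem eventually_inter_closedBall_subset_of_isOpen
    {X : Type*} [PseudoMetricSpace X] [ProperSpace X] {A U : Set X} (hA : IsClosed A)
    (hU : IsOpen U) {x : X} {r : ℝ} (h : A ∩ closedBall x r ⊆ U) :
    ∀ᶠ s in 𝓝 r, A ∩ closedBall x s ⊆ U := by
  have hC : IsCompact ((A ∩ closedBall x (r + 1)) \ U) :=
    ((isCompact_closedBall x (r + 1)).inter_left hA).diff hU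
  have hr : r + 1 > r := lt_add_one r
  rcases ((A ∩ closedBall x (r + 1)) \ U).eq_empty_or_nonempty with hne | hne
  · filter_upwards [eventually_lt_nhds hr] with s hs
    exact (inter_subset_inter_right A (closedBall_subset_closedBall hs.le)).trans
      (sdiff_eq_empty.1 hne)
  · obtain ⟨z, hz, hmin⟩ := hC.exists_isMinOn hne
      (continuous_id.dist continuous_const : Continuous fun y => dist y x).continuousOn
    have hzr : r < dist z x := not_le.1 fun hle => hz.2 (h ⟨hz.1.1, hle⟩)
    filter_upwards [eventually_lt_nhds hr, eventually_lt_nhds hzr] with s hs hsz y hy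
    by_contra hyU
    have hzy : dist z x ≤ dist y x :=
      hmin ⟨⟨hy.1, closedBall_subset_closedBall hs.le hy.2⟩, hyU⟩
    exact (hzy.trans hy.2).not_gt hsz

/-- In a pseudometric space, every point of a totally bounded set `A ∩ ball x r` is within
`ε` of the restriction of `A` to `closedBall x s`, for `s` close to `r`. -/
theorem eventually_forall_exists_edist_lt_of_totallyBounded
    {X : Type*} [PseudoMetricSpace X] {A : Set X} {x : X} {r : ℝ}
    (hA : TotallyBounded (A ∩ ball x r)) {ε : ℝ≥0∞} (hε : 0 < ε) :
    ∀ᶠ s in 𝓝 r, ∀ y ∈ A ∩ ball x r, ∃ z ∈ A ∩ closedBall x s, edist y z < ε := by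
  obtain ⟨t, ht, htf, hcov⟩ := EMetric.totallyBounded_iff'.1 hA ε hε
  have hev : ∀ᶠ s in 𝓝 r, ∀ z ∈ t, dist z x < s :=
    htf.eventually_all.2 fun z hz => eventually_gt_nhds (ht hz).2
  filter_upwards [hev] with s hs y hy
  obtain ⟨z, hz, hyz⟩ := mem_iUnion₂.1 (hcov hy)
  exact ⟨z, ⟨(ht hz).1, (hs z hz).le⟩, hyz⟩

/-- **The restriction of a closed set to closed balls is càdlàg in the radius**: for a
closed subset `A` of a proper metric space and `x ∈ X`, the map `r ↦ A ∩ B̄(x,r)` is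
right continuous in the extended Hausdorff distance at each `r > 0`, and its left limit
at `r` (along radii in `(0, r)`) is the closure of `A ∩ B(x,r)`. -/
theorem restriction_cadlag
    {X : Type*} [MetricSpace X] [ProperSpace X] (A : Set X) (hA : IsClosed A) (x : X) :
    ∀ r : ℝ, 0 < r →
      Tendsto (fun s => EMetric.hausdorffEdist
          (A ∩ Metric.closedBall x s) (A ∩ Metric.closedBall x r))
        (nhdsWithin r (Set.Ioi r)) (𝓝 0) ∧
      Tendsto (fun s => EMetric.hausdorffEdist
          (A ∩ Metric.closedBall x s) (closure (A ∩ Metric.ball x r)))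
        (nhdsWithin r (Set.Ioo 0 r)) (𝓝 0) := by
  intro r _
  refine ⟨ENNReal.tendsto_nhds_zero.2 fun ε hε => ?_, ENNReal.tendsto_nhds_zero.2 fun ε hε => ?_⟩
  · have hU : IsOpen (⋃ z ∈ A ∩ closedBall x r, eball z ε) :=
      isOpen_biUnion fun z _ => isOpen_eball
    have hsub : A ∩ closedBall x r ⊆ ⋃ z ∈ A ∩ closedBall x r, eball z ε :=
      fun z hz => mem_biUnion hz (mem_eball_self hε)
    filter_upwards [nhdsWithin_le_nhds (eventually_inter_closedBall_subset_of_isOpen hA hU hsub),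
      self_mem_nhdsWithin] with s hs hrs
    refine hausdorffEDist_le_of_mem_edist (fun y hy => ?_) fun y hy =>
      ⟨y, ⟨hy.1, closedBall_subset_closedBall (le_of_lt hrs) hy.2⟩, by simp⟩
    obtain ⟨z, hz, hyz⟩ := mem_iUnion₂.1 (hs hy)
    exact ⟨z, hz, le_of_lt hyz⟩
  · have htb : TotallyBounded (A ∩ ball x r) :=
      (isCompact_closedBall x r).totallyBounded.subset
        (inter_subset_right.trans ball_subset_closedBall)
    filter_upwards [nhdsWithin_le_nhds
      (eventually_forall_exists_edist_lt_of_totallyBounded htb hε),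
      self_mem_nhdsWithin] with s hs hsr
    refine hausdorffEDist_closure_right.trans_le (hausdorffEDist_le_of_mem_edist (fun y hy =>
      ⟨y, ⟨hy.1, closedBall_subset_ball hsr.2 hy.2⟩, by simp⟩) fun y hy => ?_)
    obtain ⟨z, hz, hyz⟩ := hs y hy
    exact ⟨z, hz, hyz.le⟩
end

section
/- Let X be a proper metric space. Let (x_n) be a sequence in X converging to x ∈ X, let A and A_n (n ∈ ℕ) be closed subsets of X, and let (r_n) be a nondecreasing sequence of positive reals tending to ∞. If dHe(A_n ∩ B̄(x_n, r_n), A ∩ B̄(x, r_n)) → 0 as n → ∞, then the set of radii { r > 0 : it is NOT the case that dHe(A_n ∩ B̄(x_n, r), A ∩ B̄(x, r)) → 0 as n → ∞ } is countable; that is, A_n ∩ B̄(x_n, r) converges to A ∩ B̄(x, r) in the Hausdorff sense for all but countably many r > 0. -/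
open Metric Set Filter
open scoped ENNReal Topology

/-- In a second-countable space, a real function restricted to a set has only countably many
local minimum values. -/
theorem countable_image_isLocalMinOn {X : Type*} [TopologicalSpace X]
    [SecondCountableTopology X] (f : X → ℝ) (S : Set X) :
    (f '' {a | a ∈ S ∧ IsLocalMinOn f S a}).Countable := by
  refine ((TopologicalSpace.countable_countableBasis X).image
    fun U => sInf (f '' (U ∩ S))).mono ?_
  rintro _ ⟨a, ⟨haS, hmin⟩, rfl⟩
  obtain ⟨V, hV, hVmin⟩ := mem_nhdsWithin_iff_exists_mem_nhds_inter.1 hmin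
  obtain ⟨U, hU, haU, hUV⟩ :=
    (TopologicalSpace.isBasis_countableBasis X).mem_nhds_iff.1 hV
  refine ⟨U, hU, IsLeast.csInf_eq ⟨⟨a, ⟨haU, haS⟩, rfl⟩, ?_⟩⟩
  rintro _ ⟨y, ⟨hyU, hyS⟩, rfl⟩
  exact hVmin ⟨hUV hyU, hyS⟩

/-- Slightly enlarging the radius of a closed ball keeps its trace on a closed subset of a proper
space within a small neighbourhood of the original trace. -/
theorem exists_closedBall_inter_thickening {X : Type*} [MetricSpace X] [ProperSpace X]
    {A : Set X} (hA : IsClosed A) (c : X) (s : ℝ) {ε : ℝ} (hε : 0 < ε) :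
    ∃ δ > 0, ∀ y ∈ A, dist y c ≤ s + δ → ∃ a ∈ A ∩ closedBall c s, dist y a < ε := by
  have hK : IsCompact (A ∩ closedBall c (s + 1)) :=
    (isCompact_closedBall c (s + 1)).inter_left hA
  have key : ∀ᶠ t in 𝓝 s, ∀ y ∈ A ∩ closedBall c (s + 1),
      dist y c ≤ t → ∃ a ∈ A ∩ closedBall c s, dist y a < ε := by
    refine hK.eventually_forall_of_forall_eventually fun a ha => ?_
    rcases le_or_gt (dist a c) s with has | has
    · have : ∀ᶠ z : ℝ × X in 𝓝 (s, a), dist z.2 a < ε :=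
        (continuous_snd.dist continuous_const).continuousAt.eventually_lt_const (by simpa)
      filter_upwards [this] with z hz _
      exact ⟨a, ⟨ha.1, has⟩, hz⟩
    · have : ∀ᶠ z : ℝ × X in 𝓝 (s, a), z.1 < dist z.2 c :=
        continuous_fst.continuousAt.eventually_lt
          (continuous_snd.dist continuous_const).continuousAt has
      filter_upwards [this] with z hz hle
      exact absurd hle hz.not_ge
  obtain ⟨η, hη, h⟩ := Metric.eventually_nhds_iff.1 key
  refine ⟨min (η / 2) 1, by positivity, fun y hy hyc => ?_⟩
  have h1 := min_le_left (η / 2) 1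
  have h2 := min_le_right (η / 2) 1
  have h3 : 0 < min (η / 2) 1 := by positivity
  refine h (y := s + min (η / 2) 1) ?_ y ⟨hy, ?_⟩ hyc
  · rw [Real.dist_eq, add_sub_cancel_left, abs_of_pos h3]
    linarith
  · rw [mem_closedBall]
    linarith

/-- Hausdorff convergence of the traces on balls of radii tending to infinity implies
convergence at every radius `s` at which the closed trace of the limit set is contained in the
closure of its open trace. -/
theorem tendsto_hausdorffEDist_inter_closedBall {X : Type*} [MetricSpace X] [ProperSpace X]
    {x : ℕ → X} {c : X} (hx : Tendsto x atTop (𝓝 c)) {A : ℕ → Set X} {B : Set X}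
    (hB : IsClosed B) {r : ℕ → ℝ} (hr : Tendsto r atTop atTop)
    (hconv : Tendsto (fun n => hausdorffEDist
      (A n ∩ closedBall (x n) (r n)) (B ∩ closedBall c (r n))) atTop (𝓝 0))
    {s : ℝ} (hs : B ∩ closedBall c s ⊆ closure (B ∩ ball c s)) :
    Tendsto (fun n => hausdorffEDist
      (A n ∩ closedBall (x n) s) (B ∩ closedBall c s)) atTop (𝓝 0) := by
  have hclose : ∀ δ : ℝ, 0 < δ → ∀ᶠ n in atTop, s ≤ r n ∧ dist (x n) c < δ ∧
      hausdorffEDist (A n ∩ closedBall (x n) (r n)) (B ∩ closedBall c (r n)) <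
        ENNReal.ofReal δ := fun δ hδ =>
    (hr.eventually_ge_atTop s).and ((Metric.tendsto_nhds.1 hx δ hδ).and
      (hconv.eventually_lt_const (ENNReal.ofReal_pos.2 hδ)))
  have hlower : ∀ ε : ℝ, 0 < ε → ∀ᶠ n in atTop, ∀ a ∈ B ∩ closedBall c s,
      ∃ b ∈ A n ∩ closedBall (x n) s, dist a b < ε := by
    intro ε hε
    have hK : IsCompact (B ∩ closedBall c s) := (isCompact_closedBall c s).inter_left hB
    have hloc : ∀ a ∈ B ∩ closedBall c s, ∃ t ∈ 𝓝[B ∩ closedBall c s] a,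
        ∀ᶠ n in atTop, ∀ y ∈ t, ∃ b ∈ A n ∩ closedBall (x n) s, dist y b < ε := by
      intro a ha
      obtain ⟨a', ⟨ha'B, ha's⟩, haa'⟩ := Metric.mem_closure_iff.1 (hs ha) (ε / 3) (by positivity)
      rw [mem_ball] at ha's
      set δ := min (ε / 3) ((s - dist a' c) / 2)
      have hδpos : 0 < δ := lt_min (by positivity) (by linarith)
      have hδ1 : δ ≤ ε / 3 := min_le_left _ _
      have hδ2 : δ ≤ (s - dist a' c) / 2 := min_le_right _ _
      refine ⟨ball a (ε / 3), mem_nhdsWithin_of_mem_nhds (ball_mem_nhds a (by positivity)), ?_⟩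
      filter_upwards [hclose δ hδpos] with n ⟨hrn, hxn, hH⟩ y hy
      rw [hausdorffEDist_comm] at hH
      obtain ⟨b, hb, hab⟩ := exists_edist_lt_of_hausdorffEDist_lt
        (mem_inter ha'B (mem_closedBall.2 (ha's.le.trans hrn))) hH
      rw [edist_lt_ofReal] at hab
      rw [mem_ball] at hy
      refine ⟨b, ⟨hb.1, mem_closedBall.2 ?_⟩, ?_⟩
      · have := dist_triangle4 b a' c (x n)
        rw [dist_comm b a', dist_comm c (x n)] at this
        linarith
      · have := dist_triangle4 y a a' b
        linarith
    refine hK.induction_on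
      (p := fun t => ∀ᶠ n in atTop, ∀ y ∈ t, ∃ b ∈ A n ∩ closedBall (x n) s, dist y b < ε)
      (by simp) (fun t u htu h => h.mono fun n hn y hy => hn y (htu hy)) ?_ hloc
    intro t u ht hu
    filter_upwards [ht, hu] with n hnt hnu y hy
    exact hy.elim (hnt y) (hnu y)
  have hupper : ∀ ε : ℝ, 0 < ε → ∀ᶠ n in atTop, ∀ b ∈ A n ∩ closedBall (x n) s,
      ∃ a ∈ B ∩ closedBall c s, dist b a < ε := by
    intro ε hε
    obtain ⟨η, hη, hthick⟩ := exists_closedBall_inter_thickening hB c s (half_pos hε)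
    have hδpos : 0 < min (ε / 2) (η / 2) := by positivity
    have hδ1 := min_le_left (ε / 2) (η / 2)
    have hδ2 := min_le_right (ε / 2) (η / 2)
    filter_upwards [hclose _ hδpos] with n ⟨hrn, hxn, hH⟩ b ⟨hbA, hbs⟩
    obtain ⟨y, hy, hby⟩ := exists_edist_lt_of_hausdorffEDist_lt
      (mem_inter hbA (closedBall_subset_closedBall hrn hbs)) hH
    rw [edist_lt_ofReal] at hby
    rw [mem_closedBall] at hbs
    obtain ⟨a, ha, hya⟩ := hthick y hy.1 (by
      have := dist_triangle4 y b (x n) c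
      rw [dist_comm y b] at this
      linarith)
    exact ⟨a, ha, by linarith [dist_triangle b y a]⟩
  refine ENNReal.tendsto_nhds_zero.2 fun ε hε => ?_
  obtain ⟨δ, hδ, hδε⟩ := ENNReal.lt_iff_exists_real_btwn.1 hε
  have hδpos : 0 < δ := ENNReal.ofReal_pos.1 hδε.1
  filter_upwards [hlower δ hδpos, hupper δ hδpos] with n hl hu
  refine (hausdorffEDist_le_of_mem_edist (fun b hb => ?_) fun a ha => ?_).trans hδε.2.le
  · obtain ⟨a, ha, h⟩ := hu b hb
    exact ⟨a, ha, (edist_lt_ofReal.2 h).le⟩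
  · obtain ⟨b, hb, h⟩ := hl a ha
    exact ⟨b, hb, (edist_lt_ofReal.2 h).le⟩

/-- **Hausdorff convergence of restrictions along increasing radii gives Hausdorff
convergence at all but countably many radii**: in a proper metric space, if `x_n → x`,
the sets `A_n, A` are closed, `r_n ↑ ∞`, and
`dHe(A_n ∩ B̄(x_n, r_n), A ∩ B̄(x, r_n)) → 0`, then the set of radii `r > 0` at which
`dHe(A_n ∩ B̄(x_n, r), A ∩ B̄(x, r))` fails to tend to `0` is countable. -/
theorem countable_bad_radii
    {X : Type*} [MetricSpace X] [ProperSpace X]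
    (x : ℕ → X) (xl : X) (hx : Tendsto x atTop (𝓝 xl))
    (A : ℕ → Set X) (hA : ∀ n, IsClosed (A n)) (Al : Set X) (hAl : IsClosed Al)
    (r : ℕ → ℝ) (hr : Monotone r) (hrpos : ∀ n, 0 < r n) (hrtop : Tendsto r atTop atTop)
    (hconv : Tendsto (fun n => EMetric.hausdorffEdist
        (A n ∩ Metric.closedBall (x n) (r n)) (Al ∩ Metric.closedBall xl (r n)))
      atTop (𝓝 0)) :
    Set.Countable {s : ℝ | 0 < s ∧
      ¬ Tendsto (fun n => EMetric.hausdorffEdist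
          (A n ∩ Metric.closedBall (x n) s) (Al ∩ Metric.closedBall xl s))
        atTop (𝓝 0)} := by
  refine (countable_image_isLocalMinOn (fun a => dist a xl) Al).mono ?_
  rintro s ⟨-, hs⟩
  by_contra hmin
  refine hs (tendsto_hausdorffEDist_inter_closedBall hx hAl hrtop hconv fun a ha => ?_)
  rcases (mem_closedBall.1 ha.2).lt_or_eq with has | has
  · exact subset_closure ⟨ha.1, has⟩
  by_contra hcl
  refine hmin ⟨a, ⟨ha.1, ?_⟩, has⟩
  have hnear : ∀ᶠ y in 𝓝[Al] a, y ∈ (closure (Al ∩ ball xl s))ᶜ :=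
    mem_nhdsWithin_of_mem_nhds (isClosed_closure.isOpen_compl.mem_nhds hcl)
  filter_upwards [hnear, self_mem_nhdsWithin] with y hy hyA
  by_contra hlt
  exact hy (subset_closure ⟨hyA, (not_le.1 hlt).trans_eq has⟩)
end

section
/- Let (T, 𝒯) be a measurable space whose σ-algebra 𝒯 is countably generated, let μ be a probability measure on T, and let S be a complete separable metric space equipped with its Borel σ-algebra. For Borel-measurable functions f, g : T → S define d₀(f, g) := ∫_T min(1, dist(f(t), g(t))) dμ(t). Then: (separability) there exists a countable family 𝒟 of measurable functions T → S such that for every measurable f : T → S and every ε > 0 there is g ∈ 𝒟 with d₀(f, g) < ε; (completeness) for every sequence (f_n) of measurable functions T → S such that for every ε > 0 there is N with d₀(f_m, f_n) < ε for all m, n ≥ N, there exists a measurable function g : T → S with d₀(f_n, g) → 0. -/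
open MeasureTheory Filter
open scoped Topology

open scoped Classical in
/-- The function equal to `c` on `A` for the first entry `(A, c)` of the list whose set contains the
argument, and to `y` if there is none. -/
noncomputable def listPiecewise {T S : Type*} (y : S) (l : List (Set T × S)) : T → S :=
  l.foldr (fun p g => p.1.piecewise (fun _ => p.2) g) fun _ => y

theorem measurable_listPiecewise {T S : Type*} [MeasurableSpace T] [MeasurableSpace S]
    (y : S) (l : List (Set T × S))
    (hl : ∀ p ∈ l, MeasurableSet p.1) : Measurable (listPiecewise y l) := by
  classical
  induction l with
  | nil => exact measurable_const
  | cons p l ih =>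
    exact measurable_const.piecewise (hl p (by simp)) (ih fun q hq => hl q (by simp [hq]))

section TruncatedDistance

variable {T S : Type*} [MeasurableSpace T] {μ : Measure T} [PseudoMetricSpace S]

/-- The integrated truncated distance, which metrizes convergence in measure. -/
noncomputable def truncDist (μ : Measure T) (f g : T → S) : ℝ :=
  ∫ t, min 1 (dist (f t) (g t)) ∂μ

theorem min_one_dist_triangle (x y z : S) :
    min 1 (dist x z) ≤ min 1 (dist x y) + min 1 (dist y z) := by
  have h := dist_triangle x y z
  have h₁ := dist_nonneg (x := x) (y := y)
  have h₂ := dist_nonneg (x := y) (y := z)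
  grind

theorem norm_min_one_dist_le (x y : S) : ‖min 1 (dist x y)‖ ≤ 1 := by
  rw [Real.norm_of_nonneg (le_min zero_le_one dist_nonneg)]
  exact min_le_left _ _

theorem cauchySeq_of_summable_min_one_dist {u : ℕ → S}
    (h : Summable fun n => min 1 (dist (u n) (u (n + 1)))) : CauchySeq u := by
  refine cauchySeq_of_summable_dist (h.congr_atTop ?_)
  filter_upwards [h.tendsto_atTop_zero.eventually_lt_const one_pos] with n hn
  exact min_eq_right (by grind)

variable [SecondCountableTopology S] [MeasurableSpace S] [BorelSpace S]

theorem measurable_min_one_dist {f g : T → S} (hf : Measurable f) (hg : Measurable g) :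
    Measurable fun t => min 1 (dist (f t) (g t)) :=
  measurable_const.min (hf.dist hg)

theorem integrable_min_one_dist [IsFiniteMeasure μ] {f g : T → S} (hf : Measurable f)
    (hg : Measurable g) : Integrable (fun t => min 1 (dist (f t) (g t))) μ :=
  .of_bound (measurable_min_one_dist hf hg).aestronglyMeasurable 1
    (.of_forall fun _ => norm_min_one_dist_le _ _)

theorem truncDist_triangle [IsFiniteMeasure μ] {f g h : T → S} (hf : Measurable f)
    (hg : Measurable g) (hh : Measurable h) :
    truncDist μ f h ≤ truncDist μ f g + truncDist μ g h := by
  rw [truncDist, truncDist, truncDist,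
    ← integral_add (integrable_min_one_dist hf hg) (integrable_min_one_dist hg hh)]
  exact integral_mono (integrable_min_one_dist hf hh)
    ((integrable_min_one_dist hf hg).add (integrable_min_one_dist hg hh))
    fun _ => min_one_dist_triangle _ _ _

theorem tendsto_truncDist_of_ae_tendsto [IsFiniteMeasure μ] {f : ℕ → T → S} {g : T → S}
    (hf : ∀ n, Measurable (f n)) (hg : Measurable g)
    (h : ∀ᵐ t ∂μ, Tendsto (fun n => f n t) atTop (𝓝 (g t))) :
    Tendsto (fun n => truncDist μ (f n) g) atTop (𝓝 0) := by
  have h₀ : (0 : ℝ) = ∫ _, 0 ∂μ := by simp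
  rw [h₀]
  refine tendsto_integral_of_dominated_convergence (fun _ => 1)
    (fun n => (measurable_min_one_dist (hf n) hg).aestronglyMeasurable) (integrable_const _)
    (fun n => .of_forall fun _ => norm_min_one_dist_le _ _) ?_
  filter_upwards [h] with t ht
  simpa using (tendsto_const_nhds (x := (1 : ℝ))).min (tendsto_iff_dist_tendsto_zero.1 ht)

open scoped Classical in
/-- Changing the set on which a function is replaced by a constant costs at most the measure of
the symmetric difference. -/
theorem truncDist_piecewise_const_le [IsFiniteMeasure μ] {f g : T → S} (hf : Measurable f)
    (hg : Measurable g) {A B : Set T} (hA : MeasurableSet A) (hB : MeasurableSet B) (c : S) :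
    truncDist μ (A.piecewise (fun _ => c) f) (B.piecewise (fun _ => c) g) ≤
      truncDist μ f g + μ.real (symmDiff A B) := by
  have hAB : MeasurableSet (symmDiff A B) := hA.symmDiff hB
  have hi : Integrable ((symmDiff A B).indicator (1 : T → ℝ)) μ :=
    (integrable_const _).indicator hAB
  rw [truncDist, truncDist, ← integral_indicator_one hAB,
    ← integral_add (integrable_min_one_dist hf hg) hi]
  refine integral_mono (integrable_min_one_dist (measurable_const.piecewise hA hf)
    (measurable_const.piecewise hB hg)) ((integrable_min_one_dist hf hg).add hi) fun t => ?_
  by_cases ha : t ∈ A <;> by_cases hb : t ∈ B <;>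
    simp [Set.mem_symmDiff, ha, hb]

theorem exists_list_truncDist_nearestPt_lt [IsFiniteMeasure μ] {𝒜 : Set (Set T)}
    (h𝒜 : μ.MeasureDense 𝒜) (e : ℕ → S) {f : T → S} (hf : Measurable f) (N : ℕ) {ε : ℝ}
    (hε : 0 < ε) :
    ∃ l : List (𝒜 × ℕ), truncDist μ (fun t => SimpleFunc.nearestPt e N (f t))
      (listPiecewise (e 0) (l.map fun p => (p.1, e p.2))) < ε := by
  classical
  induction N generalizing ε with
  | zero => exact ⟨[], by simpa [truncDist, listPiecewise] using hε⟩
  | succ N ih =>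
    obtain ⟨l, hl⟩ := ih (half_pos hε)
    set B : Set T := f ⁻¹' {x | ∀ k ≤ N, edist (e (N + 1)) x < edist (e k) x} with hB
    have hBm : MeasurableSet B := by
      refine hf ?_
      simp only [Set.ofPred_forall]
      exact .iInter fun _ => .iInter fun _ =>
        measurableSet_lt measurable_edist_right measurable_edist_right
    obtain ⟨A, hA, hAB⟩ := h𝒜.approx B hBm (measure_ne_top μ B) (ε / 2) (half_pos hε)
    have hAB' : μ.real (symmDiff B A) < ε / 2 :=
      (ENNReal.lt_ofReal_iff_toReal_lt (measure_ne_top _ _)).1 hAB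
    refine ⟨(⟨A, hA⟩, N + 1) :: l, ?_⟩
    have heq : (fun t => SimpleFunc.nearestPt e (N + 1) (f t)) =
        B.piecewise (fun _ => e (N + 1)) fun t => SimpleFunc.nearestPt e N (f t) := by
      funext t
      simp only [SimpleFunc.nearestPt, SimpleFunc.map_apply, SimpleFunc.nearestPtInd_succ,
        Set.piecewise, hB, Set.mem_preimage, Set.mem_ofPred_eq]
      split_ifs <;> rfl
    rw [heq]
    have hm := measurable_listPiecewise (e 0) (l.map fun p => ((p.1 : Set T), e p.2)) <| by
      simp only [List.mem_map]
      rintro _ ⟨p, -, rfl⟩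
      exact h𝒜.measurable _ p.1.2
    refine (truncDist_piecewise_const_le ((SimpleFunc.nearestPt e N).measurable.comp hf) hm hBm
      (h𝒜.measurable A hA) (e (N + 1))).trans_lt ?_
    exact (add_lt_add hl hAB').trans_eq (add_halves ε)

theorem exists_countable_truncDist_dense (μ : Measure T) [IsFiniteMeasure μ] [IsSeparable μ]
    [Nonempty S] :
    ∃ D : Set (T → S), D.Countable ∧ (∀ g ∈ D, Measurable g) ∧
      ∀ f : T → S, Measurable f → ∀ ε : ℝ, 0 < ε → ∃ g ∈ D, truncDist μ f g < ε := by
  obtain ⟨𝒜, h𝒜c, h𝒜⟩ := exists_countable_measureDense μ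
  have := h𝒜c.to_subtype
  let e := TopologicalSpace.denseSeq S
  let G : List (𝒜 × ℕ) → T → S := fun l =>
    listPiecewise (e 0) (l.map fun p => ((p.1 : Set T), e p.2))
  have hG : ∀ l, Measurable (G l) := fun l => measurable_listPiecewise _ _ <| by
    simp only [List.mem_map]
    rintro _ ⟨p, -, rfl⟩
    exact h𝒜.measurable _ p.1.2
  refine ⟨Set.range G, Set.countable_range G, Set.forall_mem_range.2 hG, fun f hf ε hε => ?_⟩
  have hN (N : ℕ) : Measurable fun t => SimpleFunc.nearestPt e N (f t) :=
    (SimpleFunc.nearestPt e N).measurable.comp hf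
  have hlim := tendsto_truncDist_of_ae_tendsto (μ := μ) hN hf (.of_forall fun t =>
    SimpleFunc.tendsto_nearestPt (TopologicalSpace.denseRange_denseSeq S (f t)))
  obtain ⟨N, hNε⟩ := (hlim.eventually_lt_const (half_pos hε)).exists
  obtain ⟨l, hl⟩ := exists_list_truncDist_nearestPt_lt h𝒜 e hf N (half_pos hε)
  refine ⟨G l, ⟨l, rfl⟩, (truncDist_triangle hf (hN N) (hG l)).trans_lt ?_⟩
  have hcomm : truncDist μ f (fun t => SimpleFunc.nearestPt e N (f t)) < ε / 2 := by
    simpa only [truncDist, dist_comm] using hNε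
  simpa using add_lt_add hcomm hl

theorem ae_cauchySeq_of_truncDist_lt [IsFiniteMeasure μ] {f : ℕ → T → S}
    (hf : ∀ n, Measurable (f n)) (h : ∀ n, truncDist μ (f n) (f (n + 1)) < (1 / 2) ^ n) :
    ∀ᵐ t ∂μ, CauchySeq fun n => f n t := by
  let d : ℕ → T → ℝ := fun n t => min 1 (dist (f n t) (f (n + 1) t))
  have hd₀ (n : ℕ) (t : T) : 0 ≤ d n t := le_min zero_le_one dist_nonneg
  have hdm (n : ℕ) : Measurable fun t => ENNReal.ofReal (d n t) :=
    (measurable_min_one_dist (hf n) (hf (n + 1))).ennreal_ofReal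
  have hfin : ∫⁻ t, ∑' n, ENNReal.ofReal (d n t) ∂μ ≠ ⊤ := by
    rw [lintegral_tsum fun n => (hdm n).aemeasurable]
    refine ne_top_of_le_ne_top summable_geometric_two.tsum_ofReal_ne_top
      (ENNReal.tsum_le_tsum fun n => ?_)
    rw [← ofReal_integral_eq_lintegral_ofReal (integrable_min_one_dist (hf n) (hf (n + 1)))
      (.of_forall (hd₀ n))]
    exact ENNReal.ofReal_le_ofReal (h n).le
  filter_upwards [ae_lt_top (.tsum hdm) hfin] with t ht
  refine cauchySeq_of_summable_min_one_dist ?_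
  have := ENNReal.summable_toReal ht.ne
  simpa only [ENNReal.toReal_ofReal (hd₀ _ _)] using this

theorem exists_tendsto_truncDist_of_cauchy [IsFiniteMeasure μ] [CompleteSpace S]
    {f : ℕ → T → S} (hf : ∀ n, Measurable (f n))
    (h : ∀ ε : ℝ, 0 < ε → ∃ N : ℕ, ∀ m ≥ N, ∀ n ≥ N, truncDist μ (f m) (f n) < ε) :
    ∃ g : T → S, Measurable g ∧ Tendsto (fun n => truncDist μ (f n) g) atTop (𝓝 0) := by
  obtain ⟨φ, hφ, hφd⟩ := extraction_forall_of_eventually'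
    (P := fun k N => ∀ m ≥ N, ∀ n ≥ N, truncDist μ (f m) (f n) < (1 / 2) ^ k) fun k => by
      obtain ⟨N, hN⟩ := h ((1 / 2) ^ k) (by positivity)
      exact ⟨N, fun M hM m hm n hn => hN m (hM.trans hm) n (hM.trans hn)⟩
  have hcau := ae_cauchySeq_of_truncDist_lt (fun n => hf (φ n))
    fun k => hφd k _ le_rfl _ (hφ.monotone k.le_succ)
  obtain ⟨g, hg, hlim⟩ := measurable_limit_of_tendsto_metrizable_ae
    (fun n => (hf (φ n)).aemeasurable) (hcau.mono fun _ => cauchySeq_tendsto_of_complete)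
  have hsub := tendsto_truncDist_of_ae_tendsto (fun n => hf (φ n)) hg hlim
  refine ⟨g, hg, ?_⟩
  have h₀ (n : ℕ) : 0 ≤ truncDist μ (f n) g :=
    integral_nonneg fun _ => le_min zero_le_one dist_nonneg
  refine Metric.tendsto_atTop.2 fun ε hε => ?_
  obtain ⟨N, hN⟩ := h (ε / 2) (half_pos hε)
  obtain ⟨k, hk, hkN⟩ := ((hsub.eventually_lt_const (half_pos hε)).and
    (hφ.tendsto_atTop.eventually_ge_atTop N)).exists
  refine ⟨N, fun n hn => ?_⟩
  rw [Real.dist_eq, sub_zero, abs_of_nonneg (h₀ n)]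
  have := truncDist_triangle (μ := μ) (hf n) (hf (φ k)) hg
  linarith [hN n hn (φ k) hkN]

end TruncatedDistance

/-- **The space of measurable functions with the metric of convergence in probability is
separable and complete**: for a probability measure `μ` on a measurable space `T` whose
σ-algebra is countably generated, and a complete separable metric space `S` with its
Borel σ-algebra, the pseudometric
`d₀(f,g) = ∫_T min(1, dist(f t, g t)) dμ` on measurable functions `T → S` is separable
(there is a countable family approximating every measurable function) and complete
(every Cauchy sequence converges to a measurable function). -/
theorem convInProbability_separable_complete
    {T : Type*} [MeasurableSpace T] [MeasurableSpace.CountablyGenerated T]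
    (μ : Measure T) [IsProbabilityMeasure μ]
    {S : Type*} [MetricSpace S] [CompleteSpace S] [TopologicalSpace.SeparableSpace S]
    [MeasurableSpace S] [BorelSpace S] :
    (∃ D : Set (T → S), D.Countable ∧ (∀ g ∈ D, Measurable g) ∧
        ∀ f : T → S, Measurable f → ∀ ε : ℝ, 0 < ε →
          ∃ g ∈ D, (∫ t, min 1 (dist (f t) (g t)) ∂μ) < ε) ∧
    (∀ f : ℕ → T → S, (∀ n, Measurable (f n)) →
        (∀ ε : ℝ, 0 < ε → ∃ N : ℕ, ∀ m ≥ N, ∀ n ≥ N,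
          (∫ t, min 1 (dist (f m t) (f n t)) ∂μ) < ε) →
        ∃ g : T → S, Measurable g ∧
          Tendsto (fun n => ∫ t, min 1 (dist (f n t) (g t)) ∂μ) atTop (𝓝 0)) := by
  have : SecondCountableTopology S := UniformSpace.secondCountable_of_separable S
  refine ⟨?_, fun f hf h => exists_tendsto_truncDist_of_cauchy hf h⟩
  cases isEmpty_or_nonempty S
  · obtain ⟨t⟩ := nonempty_of_isProbabilityMeasure μ
    exact ⟨∅, Set.countable_empty, by simp, fun f => isEmptyElim (f t)⟩
  · exact exists_countable_truncDist_dense μ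
end
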